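/- Let P ⊆ ℝ² be a lattice polygon and let Z = A + n₁E₁ + ⋯ + n_l E_l ⊆ P be a smallest maximal Minkowski decomposition in P (a maximal decomposition minimal with respect to inclusion among translates of Minkowski sums of segments realizing L(P)). Then for any two primitive direction vectors v_i, v_j of segments E_i, E_j appearing in Z, we have |det(v_i, v_j)| ≤ 1. -/

import Mathlib

open Pointwise

/-- The real point corresponding to a lattice point. -/
def coeV {n : ℕ} (v : Fin n → ℤ) : Fin n → ℝ := fun i => (v i : ℝ)

/-- A vector in `ℤ^n` is primitive if the gcd of its coordinates is `1`. -/
def IsPrim {n : ℕ} (v : Fin n → ℤ) : Prop := Finset.univ.gcd v = 1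

/-- The zonotope with base lattice point `A` obtained as the Minkowski sum of the
lattice segments `[0, v i]`. -/
def Zono {n L : ℕ} (A : Fin n → ℤ) (v : Fin L → Fin n → ℤ) : Set (Fin n → ℝ) :=
  ({coeV A} : Set (Fin n → ℝ)) + ∑ i, segment ℝ 0 (coeV (v i))

/-- `P` contains (a translate of) a Minkowski sum of `L` primitive lattice segments. -/
def IsDecomp {n : ℕ} (P : Set (Fin n → ℝ)) (L : ℕ) : Prop :=
  ∃ (A : Fin n → ℤ) (v : Fin L → Fin n → ℤ), (∀ i, IsPrim (v i)) ∧ Zono A v ⊆ P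

/-- `L` is the Minkowski length of `P`. -/
def MinkLen {n : ℕ} (P : Set (Fin n → ℝ)) (L : ℕ) : Prop :=
  IsDecomp P L ∧ ∀ M, IsDecomp P M → M ≤ L

/-- `P` is a lattice polytope: the convex hull of a nonempty finite set of lattice points. -/
def IsLatticePolytope {n : ℕ} (P : Set (Fin n → ℝ)) : Prop :=
  ∃ S : Finset (Fin n → ℤ), S.Nonempty ∧ P = convexHull ℝ (coeV '' ↑S)

/-- `Zono A v` is a smallest maximal Minkowski decomposition in `P`: it realizes the
Minkowski length of `P` and is minimal with respect to inclusion among all maximal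
decompositions in `P`. -/
def IsSmallestMax {n L : ℕ} (P : Set (Fin n → ℝ)) (A : Fin n → ℤ)
    (v : Fin L → Fin n → ℤ) : Prop :=
  (∀ i, IsPrim (v i)) ∧ Zono A v ⊆ P ∧ MinkLen P L ∧
    ∀ (B : Fin n → ℤ) (w : Fin L → Fin n → ℤ), (∀ i, IsPrim (w i)) →
      Zono B w ⊆ P → Zono B w ⊆ Zono A v → Zono B w = Zono A v

/-- A point lies in a zonotope iff it is the base point plus a combination of the generators
with coefficients in `[0, 1]`. -/
theorem mem_Zono {n L : ℕ} {A : Fin n → ℤ} {v : Fin L → Fin n → ℤ} {x : Fin n → ℝ} :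
    x ∈ Zono A v ↔ ∃ t : Fin L → ℝ, (∀ i, t i ∈ Set.Icc (0 : ℝ) 1) ∧
      x = coeV A + ∑ i, t i • coeV (v i) := by
  simp only [Zono, Set.singleton_add, Set.mem_image, Set.mem_fintype_sum, segment_eq_image,
    smul_zero, zero_add]
  constructor
  · rintro ⟨_, ⟨g, hg, rfl⟩, rfl⟩
    choose t ht hgt using hg
    exact ⟨t, ht, by simp only [hgt]⟩
  · rintro ⟨t, ht, rfl⟩
    exact ⟨_, ⟨fun i => t i • coeV (v i), fun i => ⟨t i, ht i, rfl⟩, rfl⟩, rfl⟩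

/-- The width of a zonotope in a given direction is monotone under inclusion. -/
theorem sum_abs_le_of_Zono_subset {n L M : ℕ} {A B : Fin n → ℤ} {v : Fin L → Fin n → ℤ}
    {w : Fin M → Fin n → ℤ} (hsub : Zono A v ⊆ Zono B w) (f : (Fin n → ℝ) →ₗ[ℝ] ℝ) :
    ∑ i, |f (coeV (v i))| ≤ ∑ i, |f (coeV (w i))| := by
  obtain ⟨s, hs, hsx⟩ := mem_Zono.1 (hsub (mem_Zono.2
    ⟨fun i => if 0 < f (coeV (v i)) then 1 else 0, fun i => by dsimp only; split_ifs <;> simp, rfl⟩))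
  obtain ⟨t, ht, htx⟩ := mem_Zono.1 (hsub (mem_Zono.2
    ⟨fun i => if 0 < f (coeV (v i)) then 0 else 1, fun i => by dsimp only; split_ifs <;> simp, rfl⟩))
  have hs' := congrArg f hsx
  have ht' := congrArg f htx
  simp only [map_add, map_sum, map_smul, smul_eq_mul] at hs' ht'
  calc ∑ i, |f (coeV (v i))|
      = ∑ i, (if 0 < f (coeV (v i)) then 1 else 0) * f (coeV (v i))
        - ∑ i, (if 0 < f (coeV (v i)) then 0 else 1) * f (coeV (v i)) := by
        rw [← Finset.sum_sub_distrib]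
        refine Finset.sum_congr rfl fun i _ => ?_
        split_ifs with h
        · simp [abs_of_pos h]
        · simp [abs_of_nonpos (not_lt.1 h)]
    _ = ∑ i, (s i - t i) * f (coeV (w i)) := by
        simp only [sub_mul, Finset.sum_sub_distrib]
        linarith
    _ ≤ ∑ i, |f (coeV (w i))| := by
        refine Finset.sum_le_sum fun i _ => (le_abs_self _).trans ?_
        rw [abs_mul]
        refine mul_le_of_le_one_left (abs_nonneg _) (abs_le.2 ⟨?_, ?_⟩) <;>
          linarith [(hs i).1, (hs i).2, (ht i).1, (ht i).2]

theorem sum_eq_add_add_sum_compl_pair {ι M : Type*} [Fintype ι] [DecidableEq ι]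
    [AddCommMonoid M] {i j : ι} (hij : i ≠ j) (f : ι → M) :
    ∑ l, f l = f i + f j + ∑ l ∈ ({i, j} : Finset ι)ᶜ, f l := by
  rw [← Finset.sum_add_sum_compl {i, j} f, Finset.sum_pair hij]

theorem coeV_add {n : ℕ} (x y : Fin n → ℤ) : coeV (x + y) = coeV x + coeV y := by
  ext i; simp [coeV]

theorem coeV_smul {n : ℕ} (k : ℤ) (x : Fin n → ℤ) : coeV (k • x) = (k : ℝ) • coeV x := by
  ext i; simp [coeV]

/-- A nonzero lattice vector is a positive multiple of a primitive one. -/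
theorem exists_isPrim_smul {n : ℕ} {u : Fin n → ℤ} (hu : u ≠ 0) :
    ∃ (k : ℤ) (w : Fin n → ℤ), 1 ≤ k ∧ IsPrim w ∧ u = k • w := by
  obtain ⟨i, hi⟩ := Function.ne_iff.1 hu
  obtain ⟨w, hw, hg⟩ := Finset.extract_gcd u (s := Finset.univ) ⟨i, Finset.mem_univ i⟩
  refine ⟨Finset.univ.gcd u, w, ?_, hg, ?_⟩
  · have h0 : Finset.univ.gcd u ≠ 0 := fun h =>
      hi (Finset.gcd_eq_zero_iff.1 h i (Finset.mem_univ i))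
    have h1 : 0 ≤ Finset.univ.gcd u := by
      rw [← Finset.normalize_gcd, ← Int.abs_eq_normalize]
      exact abs_nonneg _
    omega
  · ext j
    simpa using hw j (Finset.mem_univ j)

/-- A parallelogram spanned by lattice vectors, one of them primitive, with determinant at least
`2` in absolute value contains a lattice point that is not a vertex. -/
theorem exists_lattice_point {a b : Fin 2 → ℤ} (hb : IsPrim b)
    (hd : 1 < |a 0 * b 1 - a 1 * b 0|) :
    ∃ (q : Fin 2 → ℤ) (s t : ℝ), s ∈ Set.Ico (0 : ℝ) 1 ∧ t ∈ Set.Ico (0 : ℝ) 1 ∧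
      ¬(s = 0 ∧ t = 0) ∧ coeV q = s • coeV a + t • coeV b := by
  set d := a 0 * b 1 - a 1 * b 0 with hd_def
  have hd0 : d ≠ 0 := by rintro h; simp [h] at hd
  have hdR : (d : ℝ) ≠ 0 := by exact_mod_cast hd0
  have hdR' : (d : ℝ) = a 0 * b 1 - a 1 * b 0 := by rw [hd_def]; push_cast; ring
  have hndvd : ∃ k, ¬ d ∣ b k := by
    by_contra! h
    have h1 : d ∣ Finset.univ.gcd b := Finset.dvd_gcd fun k _ => h k
    rw [show Finset.univ.gcd b = 1 from hb] at h1
    have := Int.isUnit_iff_abs_eq.1 (isUnit_of_dvd_one h1)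
    omega
  obtain ⟨x, hx⟩ : ∃ x : Fin 2 → ℤ, ¬ d ∣ x 0 * b 1 - x 1 * b 0 := by
    obtain ⟨k, hk⟩ := hndvd
    fin_cases k
    · exact ⟨![0, 1], by simpa using hk⟩
    · exact ⟨![1, 0], by simpa using hk⟩
  set S : ℝ := ((x 0 * b 1 - x 1 * b 0 : ℤ) : ℝ) / d with hS
  set T : ℝ := ((a 0 * x 1 - a 1 * x 0 : ℤ) : ℝ) / d with hT
  have hST : coeV x = S • coeV a + T • coeV b := by
    ext k
    simp only [coeV, Pi.add_apply, Pi.smul_apply, smul_eq_mul, hS, hT]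
    field_simp
    rw [hdR']
    push_cast
    fin_cases k <;> simp <;> ring
  refine ⟨x + (-⌊S⌋) • a + (-⌊T⌋) • b, Int.fract S, Int.fract T,
    ⟨Int.fract_nonneg _, Int.fract_lt_one _⟩, ⟨Int.fract_nonneg _, Int.fract_lt_one _⟩, ?_, ?_⟩
  · rintro ⟨h, -⟩
    apply hx
    obtain ⟨z, hz⟩ := Int.fract_eq_zero_iff.1 h
    refine ⟨z, ?_⟩
    rw [hS, eq_div_iff hdR] at hz
    rw [mul_comm d]
    exact_mod_cast hz.symm
  · rw [coeV_add, coeV_add, coeV_smul, coeV_smul, hST, Int.fract, Int.fract]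
    push_cast
    module

/-- A parallelogram spanned by lattice vectors, one of them primitive, with determinant at least
`2` in absolute value contains a lattice segment of even lattice length. -/
theorem exists_segment_two {a b : Fin 2 → ℤ} (hb : IsPrim b)
    (hd : 1 < |a 0 * b 1 - a 1 * b 0|) :
    ∃ (p u : Fin 2 → ℤ) (s t s' t' : ℝ), u ≠ 0 ∧
      s ∈ Set.Icc (0 : ℝ) 1 ∧ t ∈ Set.Icc (0 : ℝ) 1 ∧
      s' ∈ Set.Icc (0 : ℝ) 1 ∧ t' ∈ Set.Icc (0 : ℝ) 1 ∧
      coeV p = s • coeV a + t • coeV b ∧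
      coeV p + (2 : ℝ) • coeV u = s' • coeV a + t' • coeV b := by
  obtain ⟨q, s, t, hs, ht, hst, hq⟩ := exists_lattice_point hb hd
  have hdet : (a 0 * b 1 - a 1 * b 0 : ℝ) ≠ 0 := by
    intro h
    have : a 0 * b 1 - a 1 * b 0 = 0 := by exact_mod_cast h
    simp [this] at hd
  have hindep : ∀ {s t s' t' : ℝ}, s • coeV a + t • coeV b = s' • coeV a + t' • coeV b →
      s = s' ∧ t = t' := by
    intro s t s' t' h
    have h0 := congrFun h 0
    have h1 := congrFun h 1
    simp only [coeV, Pi.add_apply, Pi.smul_apply, smul_eq_mul] at h0 h1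
    constructor <;> apply mul_right_cancel₀ hdet
    · linear_combination (b 1 : ℝ) * h0 - (b 0 : ℝ) * h1
    · linear_combination (a 0 : ℝ) * h1 - (a 1 : ℝ) * h0
  let c : Fin 5 → ℝ × ℝ := ![(0, 0), (1, 0), (0, 1), (1, 1), (s, t)]
  let g : Fin 5 → Fin 2 → ℤ := ![0, a, b, a + b, q]
  have hgc : ∀ k, coeV (g k) = (c k).1 • coeV a + (c k).2 • coeV b := by
    intro k
    fin_cases k
    · ext; simp [g, c, coeV]
    · simp [g, c]
    · simp [g, c]
    · simp [g, c, coeV_add]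
    · simpa [g, c] using hq
  have hc : ∀ k, (c k).1 ∈ Set.Icc (0 : ℝ) 1 ∧ (c k).2 ∈ Set.Icc (0 : ℝ) 1 := by
    intro k
    fin_cases k <;> simp [c, hs.1, hs.2.le, ht.1, ht.2.le]
  have hcinj : Function.Injective c := by
    have h1 := hs.2.ne
    have h2 := ht.2.ne
    intro k l hkl
    fin_cases k <;> fin_cases l <;> simp [c, eq_comm] at hkl ⊢ <;> grind
  obtain ⟨k, l, hkl, hmod⟩ := Fintype.exists_ne_map_eq_of_card_lt
    (fun k => ((g k 0 : ZMod 2), (g k 1 : ZMod 2))) (by simp)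
  simp only [Prod.mk.injEq, ZMod.intCast_eq_intCast_iff_dvd_sub] at hmod
  obtain ⟨⟨u₀, h₀⟩, ⟨u₁, h₁⟩⟩ := hmod
  have hgu : coeV (g k) + (2 : ℝ) • coeV ![u₀, u₁] = coeV (g l) := by
    rw [← Int.cast_two, ← coeV_smul, ← coeV_add]
    congr 1
    ext m
    fin_cases m <;> simp at h₀ h₁ ⊢ <;> linarith
  refine ⟨g k, ![u₀, u₁], (c k).1, (c k).2, (c l).1, (c l).2, ?_, (hc k).1, (hc k).2,
    (hc l).1, (hc l).2, hgc k, hgu.trans (hgc l)⟩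
  intro hu
  rw [hu, ← Int.cast_two, ← coeV_smul, smul_zero, ← coeV_add, add_zero, hgc, hgc] at hgu
  exact hkl (hcinj (Prod.ext (hindep hgu).1 (hindep hgu).2))

/-- In a smallest maximal Minkowski decomposition of a lattice polygon, any two primitive
direction vectors span a parallelogram of area at most 1. -/
theorem stmt4 {L : ℕ} (P : Set (Fin 2 → ℝ)) (hP : IsLatticePolytope P)
    (A : Fin 2 → ℤ) (v : Fin L → Fin 2 → ℤ) (h : IsSmallestMax P A v) :
    ∀ i j, |v i 0 * v j 1 - v i 1 * v j 0| ≤ 1 := by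
  by_contra! hcon
  obtain ⟨i, j, hd⟩ := hcon
  obtain ⟨hprim, hsub, -, hmin⟩ := h
  have hij : i ≠ j := by
    rintro rfl
    simp [mul_comm] at hd
  obtain ⟨p, u, s, t, s', t', hu, hs, ht, hs', ht', hp, hpu⟩ := exists_segment_two (hprim j) hd
  obtain ⟨k, e, hk, he, rfl⟩ := exists_isPrim_smul hu
  have hkR : (1 : ℝ) ≤ k := by exact_mod_cast hk
  let w : Fin L → Fin 2 → ℤ := fun l => if l = i ∨ l = j then e else v l
  have hwi : w i = e := by simp [w]
  have hwj : w j = e := by simp [w]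
  have hw : ∀ l ∈ ({i, j} : Finset (Fin L))ᶜ, w l = v l := by
    intro l hl
    have : ¬(l = i ∨ l = j) := by simpa using hl
    simp [w, this]
  have hwprim : ∀ l, IsPrim (w l) := by
    intro l
    by_cases hl : l = i ∨ l = j <;> simp [w, hl, he, hprim]
  have hwsub : Zono (A + p) w ⊆ Zono A v := by
    intro x hx
    obtain ⟨r, hr, rfl⟩ := mem_Zono.1 hx
    set τ : ℝ := (r i + r j) / (2 * k) with hτ
    have hτ0 : 0 ≤ τ := div_nonneg (add_nonneg (hr i).1 (hr j).1) (by linarith)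
    have hτ1 : τ ≤ 1 := (div_le_one (by linarith)).2 (by linarith [(hr i).2, (hr j).2])
    have hconv : ∀ {y z : ℝ}, y ∈ Set.Icc (0 : ℝ) 1 → z ∈ Set.Icc (0 : ℝ) 1 →
        (1 - τ) * y + τ * z ∈ Set.Icc (0 : ℝ) 1 := fun hy hz =>
      convex_Icc (0 : ℝ) 1 hy hz (sub_nonneg.2 hτ1) hτ0 (by ring)
    refine mem_Zono.2 ⟨fun l => if l = i then (1 - τ) * s + τ * s' else
      if l = j then (1 - τ) * t + τ * t' else r l, fun l => ?_, ?_⟩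
    · dsimp only
      split_ifs
      exacts [hconv hs hs', hconv ht ht', hr l]
    · rw [sum_eq_add_add_sum_compl_pair hij, sum_eq_add_add_sum_compl_pair hij, hwi, hwj]
      have hrest : ∑ l ∈ ({i, j} : Finset (Fin L))ᶜ, r l • coeV (w l) =
          ∑ l ∈ ({i, j} : Finset (Fin L))ᶜ, (if l = i then (1 - τ) * s + τ * s' else
            if l = j then (1 - τ) * t + τ * t' else r l) • coeV (v l) := by
        refine Finset.sum_congr rfl fun l hl => ?_
        have hl' : l ≠ i ∧ l ≠ j := by simpa using hl
        simp [hw l hl, hl'.1, hl'.2]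
      have hre : r i + r j = τ * (2 * k) := by
        rw [hτ, div_mul_cancel₀]
        linarith
      have hmid : coeV p + (r i • coeV e + r j • coeV e) =
          ((1 - τ) * s + τ * s') • coeV (v i) + ((1 - τ) * t + τ * t') • coeV (v j) := by
        calc coeV p + (r i • coeV e + r j • coeV e)
            = (1 - τ) • coeV p + τ • (coeV p + (2 : ℝ) • coeV (k • e)) := by
              rw [← add_smul, hre, coeV_smul]
              module
          _ = _ := by
              rw [hpu, hp]
              module
      dsimp only
      rw [hrest, coeV_add, if_pos rfl, if_neg hij.symm, if_pos rfl, ← hmid]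
      abel
  have heq := hmin (A + p) w hwprim (hwsub.trans hsub) hwsub
  let f : (Fin 2 → ℝ) →ₗ[ℝ] ℝ :=
    (e 1 : ℝ) • LinearMap.proj 0 - (e 0 : ℝ) • LinearMap.proj 1
  have hf : ∀ y : Fin 2 → ℤ, f (coeV y) = e 1 * y 0 - e 0 * y 1 := fun y => by simp [f, coeV]
  have hwidth := sum_abs_le_of_Zono_subset heq.ge f
  have hrest : ∑ l ∈ ({i, j} : Finset (Fin L))ᶜ, |f (coeV (w l))| =
      ∑ l ∈ ({i, j} : Finset (Fin L))ᶜ, |f (coeV (v l))| :=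
    Finset.sum_congr rfl fun l hl => by rw [hw l hl]
  rw [sum_eq_add_add_sum_compl_pair hij, sum_eq_add_add_sum_compl_pair hij, hwi, hwj,
    hrest] at hwidth
  have hfe : f (coeV e) = 0 := by rw [hf]; ring
  rw [hfe, abs_zero] at hwidth
  have hi : f (coeV (v i)) = 0 :=
    abs_eq_zero.1 (by linarith [abs_nonneg (f (coeV (v i))), abs_nonneg (f (coeV (v j)))])
  have hj : f (coeV (v j)) = 0 :=
    abs_eq_zero.1 (by linarith [abs_nonneg (f (coeV (v i))), abs_nonneg (f (coeV (v j)))])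
  rw [hf] at hi hj
  have hi' : e 1 * v i 0 - e 0 * v i 1 = 0 := by exact_mod_cast hi
  have hj' : e 1 * v j 0 - e 0 * v j 1 = 0 := by exact_mod_cast hj
  have hd0 : v i 0 * v j 1 - v i 1 * v j 0 ≠ 0 := fun h0 => by simp [h0] at hd
  have he0 : e 0 = 0 := mul_right_cancel₀ hd0 (by linear_combination v j 0 * hi' - v i 0 * hj')
  have he1 : e 1 = 0 := mul_right_cancel₀ hd0 (by linear_combination v j 1 * hi' - v i 1 * hj')
  apply hu
  ext m
  fin_cases m <;> simp [he0, he1]
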